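/- Let F : ℝ^N → ℝ be a smooth solution of the associativity equations with respect to a constant symmetric invertible N×N matrix η, let F̃ : ℝ^{N+2} → ℝ be defined by F̃ = (1/2)(Σ_{α,β=1}^{N} η_{αβ} t^α t^β t⁰ + (t⁰)² t^{N+1}) + F(t¹,…,t^N), and let η̃ be the (N+2)×(N+2) symmetric invertible matrix with η̃_{0,N+1} = η̃_{N+1,0} = 1, η̃_{αβ} = η_{αβ} for 1 ≤ α,β ≤ N, and all other entries zero. Define structure constants c^k_{ij}(t) = Σ_l η̃^{kl} ∂³F̃/∂t^l∂t^i∂t^j for 0 ≤ i,j,k ≤ N+1, where η̃^{kl} are the entries of η̃^{−1}, and the product e_i · e_j = Σ_k c^k_{ij} e_k on the standard basis e_0,…,e_{N+1} of ℝ^{N+2}. Then for every t: (i) e_0 is a unit, i.e., c^k_{0j}(t) = δ^k_j for all j, k; and (ii) e_{N+1} is nilpotent with e_{N+1}·e_{N+1} = 0, i.e., c^k_{N+1,N+1}(t) = 0 for all k. -/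

import Mathlib

/-- The partial derivative `∂f/∂t^i` at `t`, for `f : ℝ^ι → ℝ`. -/
noncomputable def pd {ι : Type} [Fintype ι] [DecidableEq ι]
    (f : (ι → ℝ) → ℝ) (i : ι) (t : ι → ℝ) : ℝ :=
  fderiv ℝ f t (Pi.single i 1)

/-- The third partial derivative `∂³f/∂t^a∂t^b∂t^c` at `t`. -/
noncomputable def thd {ι : Type} [Fintype ι] [DecidableEq ι]
    (f : (ι → ℝ) → ℝ) (a b c : ι) (t : ι → ℝ) : ℝ :=
  pd (pd (pd f c) b) a t

/-- The associativity (WDVV) equations for `f` with respect to the inverse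
metric entries `ηinv`. -/
def WDVV {ι : Type} [Fintype ι] [DecidableEq ι]
    (f : (ι → ℝ) → ℝ) (ηinv : Matrix ι ι ℝ) : Prop :=
  ∀ t : ι → ℝ, ∀ α β γ δ : ι,
    (∑ l, ∑ m, thd f α β l t * ηinv l m * thd f γ δ m t) =
      ∑ l, ∑ m, thd f γ β l t * ηinv l m * thd f α δ m t

/-- The index type of the extended Frobenius structure: `0`, `1,…,N`, `N+1`. -/
abbrev ExtIdx (N : ℕ) : Type := Unit ⊕ Fin N ⊕ Unit

/-- The extended metric `η̃`. -/
noncomputable def extEta {N : ℕ} (η : Matrix (Fin N) (Fin N) ℝ) :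
    Matrix (ExtIdx N) (ExtIdx N) ℝ :=
  Matrix.of fun i j =>
    match i, j with
    | Sum.inl _, Sum.inr (Sum.inr _) => 1
    | Sum.inr (Sum.inr _), Sum.inl _ => 1
    | Sum.inr (Sum.inl a), Sum.inr (Sum.inl b) => η a b
    | _, _ => 0

/-- The extended prepotential
`F̃ = ½(Σ_{α,β} η_{αβ} t^α t^β t⁰ + (t⁰)² t^{N+1}) + F(t¹,…,t^N)`. -/
noncomputable def extF {N : ℕ} (η : Matrix (Fin N) (Fin N) ℝ) (F : (Fin N → ℝ) → ℝ) :
    ((ExtIdx N) → ℝ) → ℝ :=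
  fun t =>
    (1 / 2) * ((∑ α, ∑ β, η α β * t (Sum.inr (Sum.inl α)) * t (Sum.inr (Sum.inl β)))
        * t (Sum.inl ()) +
      (t (Sum.inl ())) ^ 2 * t (Sum.inr (Sum.inr ()))) +
    F (fun i => t (Sum.inr (Sum.inl i)))

/-- The structure constants `c^k_{ij}(t) = Σ_l η̃^{kl} ∂³F̃/∂t^l∂t^i∂t^j` of the
extended Frobenius algebra. -/
noncomputable def extC {N : ℕ} (η : Matrix (Fin N) (Fin N) ℝ)
    (F : (Fin N → ℝ) → ℝ) (k i j : ExtIdx N) (t : ExtIdx N → ℝ) : ℝ :=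
  ∑ l, (extEta η)⁻¹ k l * thd (extF η F) l i j t

open scoped Matrix

/-- A partial derivative is the derivative along the corresponding coordinate line. -/
theorem pd_eq_of_hasDerivAt {ι : Type} [Fintype ι] [DecidableEq ι]
    {f : (ι → ℝ) → ℝ} {i : ι} {t : ι → ℝ} {d : ℝ} (hf : DifferentiableAt ℝ f t)
    (h : HasDerivAt (fun s : ℝ => f (t + s • Pi.single i 1)) d 0) : pd f i t = d := by
  rw [pd, ← hf.lineDeriv_eq_fderiv]
  exact h.deriv

/-- Partial derivatives of a `C²` function commute. -/
theorem pd_comm {ι : Type} [Fintype ι] [DecidableEq ι] {f : (ι → ℝ) → ℝ}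
    (hf : ContDiff ℝ 2 f) (i j : ι) : pd (pd f i) j = pd (pd f j) i := by
  have key (a b : ι) (t : ι → ℝ) : pd (pd f a) b t =
      fderiv ℝ (fderiv ℝ f) t (Pi.single b 1) (Pi.single a 1) := by
    have hd : DifferentiableAt ℝ (fderiv ℝ f) t :=
      (hf.fderiv_right (m := 1) (by norm_num)).differentiable (by norm_num) t
    change fderiv ℝ (fun x => fderiv ℝ f x (Pi.single a 1)) t (Pi.single b 1) = _
    rw [fderiv_clm_apply hd (differentiableAt_const _)]
    simp
  funext t
  rw [key, key]
  exact hf.contDiffAt.isSymmSndFDerivAt (by simp) _ _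

theorem pd_linear {ι : Type} [Fintype ι] [DecidableEq ι] (v : ι → ℝ) (i : ι) (t : ι → ℝ) :
    pd (fun x => v ⬝ᵥ x) i t = v i := by
  refine pd_eq_of_hasDerivAt (by unfold dotProduct; fun_prop) ?_
  simp only [dotProduct_add, dotProduct_smul, dotProduct_single, mul_one, smul_eq_mul]
  simpa using ((hasDerivAt_id (0 : ℝ)).mul_const (v i)).const_add (v ⬝ᵥ t)

/-- The gradient of the quadratic form of a symmetric matrix. -/
theorem pd_quadratic {ι : Type} [Fintype ι] [DecidableEq ι] {A : Matrix ι ι ℝ}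
    (hA : A.IsSymm) (i : ι) :
    pd (fun x => (1 / 2) * (x ⬝ᵥ A *ᵥ x)) i = fun t => A i ⬝ᵥ t := by
  funext t
  refine pd_eq_of_hasDerivAt (by unfold Matrix.mulVec dotProduct; fun_prop) ?_
  have hcol : t ⬝ᵥ A.col i = A i ⬝ᵥ t := by
    rw [dotProduct_comm]
    congr 1
    funext j
    exact hA.apply i j
  have hline (s : ℝ) : (1 / 2) * ((t + s • Pi.single i 1) ⬝ᵥ A *ᵥ (t + s • Pi.single i 1)) =
      (1 / 2) * (t ⬝ᵥ A *ᵥ t) + s * (A i ⬝ᵥ t) + (1 / 2) * A i i * s ^ 2 := by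
    simp only [Matrix.mulVec_add, Matrix.mulVec_smul, add_dotProduct, dotProduct_add,
      dotProduct_smul, smul_dotProduct, Matrix.mulVec_single_one, single_dotProduct, one_mul,
      smul_eq_mul, hcol]
    simp only [Matrix.mulVec, Matrix.col_apply]
    ring
  simp only [hline]
  have h := (((hasDerivAt_id (0 : ℝ)).mul_const (A i ⬝ᵥ t)).const_add
    ((1 / 2) * (t ⬝ᵥ A *ᵥ t))).add (((hasDerivAt_id (0 : ℝ)).pow 2).const_mul ((1 / 2) * A i i))
  exact h.congr_deriv (by simp)

theorem extEta_isSymm {N : ℕ} {η : Matrix (Fin N) (Fin N) ℝ} (hsym : η.IsSymm) :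
    (extEta η).IsSymm := by
  ext i j
  rcases i with _ | i | _ <;> rcases j with _ | j | _ <;> simp [extEta, hsym.apply]

theorem extEta_inv_mul {N : ℕ} {η : Matrix (Fin N) (Fin N) ℝ} (hdet : IsUnit η.det) :
    (extEta η)⁻¹ * extEta η = 1 := by
  have h : extEta η⁻¹ * extEta η = 1 := by
    ext i j
    have hη := fun a b => congrFun (congrFun (Matrix.nonsing_inv_mul η hdet) a) b
    simp only [Matrix.mul_apply, Matrix.one_apply] at hη
    rcases i with _ | i | _ <;> rcases j with _ | j | _ <;>
      simp [extEta, Matrix.mul_apply, Matrix.one_apply, hη]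
  rw [Matrix.inv_eq_left_inv h, h]

theorem contDiff_extF {N : ℕ} (η : Matrix (Fin N) (Fin N) ℝ) {F : (Fin N → ℝ) → ℝ}
    {n : WithTop ℕ∞} (hF : ContDiff ℝ n F) : ContDiff ℝ n (extF η F) := by
  unfold extF
  fun_prop

/-- The derivative of `extF` in the unit direction is the quadratic form of `extEta`. -/
theorem pd_extF_unit {N : ℕ} (η : Matrix (Fin N) (Fin N) ℝ) {F : (Fin N → ℝ) → ℝ}
    (hF : Differentiable ℝ F) :
    pd (extF η F) (Sum.inl ()) = fun t => (1 / 2) * (t ⬝ᵥ extEta η *ᵥ t) := by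
  funext t
  refine pd_eq_of_hasDerivAt (by unfold extF; fun_prop) ?_
  simp only [extF, Pi.add_apply, Pi.smul_apply, Pi.single_apply, smul_eq_mul, reduceCtorEq,
    if_true, if_false, mul_zero, add_zero, mul_one]
  have hquad : t ⬝ᵥ extEta η *ᵥ t =
      (∑ α, ∑ β, η α β * t (Sum.inr (Sum.inl α)) * t (Sum.inr (Sum.inl β))) +
        2 * t (Sum.inl ()) * t (Sum.inr (Sum.inr ())) := by
    have hmid : ∀ α β, t (Sum.inr (Sum.inl α)) * (η α β * t (Sum.inr (Sum.inl β))) =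
        η α β * t (Sum.inr (Sum.inl α)) * t (Sum.inr (Sum.inl β)) := fun α β => by ring
    simp [dotProduct, Matrix.mulVec, extEta, Finset.mul_sum, hmid]
    ring
  rw [hquad]
  have hs := (hasDerivAt_id (0 : ℝ)).const_add (t (Sum.inl ()))
  refine HasDerivAt.congr_deriv ((((hs.const_mul (∑ α, ∑ β, η α β * t (Sum.inr (Sum.inl α)) *
    t (Sum.inr (Sum.inl β)))).add ((hs.pow 2).mul_const (t (Sum.inr (Sum.inr ()))))).const_mul
      (1 / 2 : ℝ)).add_const (F fun i => t (Sum.inr (Sum.inl i)))) ?_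
  simp

theorem pd_extF_nilpotent {N : ℕ} (η : Matrix (Fin N) (Fin N) ℝ) {F : (Fin N → ℝ) → ℝ}
    (hF : Differentiable ℝ F) :
    pd (extF η F) (Sum.inr (Sum.inr ())) = fun t => (1 / 2) * t (Sum.inl ()) ^ 2 := by
  funext t
  refine pd_eq_of_hasDerivAt (by unfold extF; fun_prop) ?_
  simp only [extF, Pi.add_apply, Pi.smul_apply, Pi.single_apply, smul_eq_mul, reduceCtorEq,
    Sum.inr.injEq, if_true, if_false, mul_zero, add_zero, mul_one]
  have hs := (hasDerivAt_id (0 : ℝ)).const_add (t (Sum.inr (Sum.inr ())))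
  refine HasDerivAt.congr_deriv ((((hs.const_mul (t (Sum.inl ()) ^ 2)).const_add ((∑ α, ∑ β, η α β *
    t (Sum.inr (Sum.inl α)) * t (Sum.inr (Sum.inl β))) * t (Sum.inl ()))).const_mul
      (1 / 2 : ℝ)).add_const (F fun i => t (Sum.inr (Sum.inl i)))) ?_
  simp

/-- The third derivatives of `extF` involving the unit direction recover the metric. -/
theorem thd_extF_unit {N : ℕ} {η : Matrix (Fin N) (Fin N) ℝ} (hsym : η.IsSymm)
    {F : (Fin N → ℝ) → ℝ} (hF : ContDiff ℝ 2 F) (l j : ExtIdx N) (t : ExtIdx N → ℝ) :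
    thd (extF η F) l (Sum.inl ()) j t = extEta η l j := by
  rw [thd, pd_comm (contDiff_extF η hF), pd_extF_unit η (hF.differentiable (by norm_num)),
    pd_quadratic (extEta_isSymm hsym), pd_linear, (extEta_isSymm hsym).apply]

theorem thd_extF_nilpotent {N : ℕ} (η : Matrix (Fin N) (Fin N) ℝ) {F : (Fin N → ℝ) → ℝ}
    (hF : Differentiable ℝ F) (l : ExtIdx N) (t : ExtIdx N → ℝ) :
    thd (extF η F) l (Sum.inr (Sum.inr ())) (Sum.inr (Sum.inr ())) t = 0 := by
  have h : pd (fun x : ExtIdx N → ℝ => (1 / 2) * x (Sum.inl ()) ^ 2) (Sum.inr (Sum.inr ())) =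
      fun _ => 0 := by
    funext x
    refine pd_eq_of_hasDerivAt (by fun_prop) ?_
    simpa using hasDerivAt_const (0 : ℝ) (2⁻¹ * x (Sum.inl ()) ^ 2)
  rw [thd, pd_extF_nilpotent η hF, h]
  simp [pd]

/-- In the extended Frobenius algebra with structure constants
`c^k_{ij} = Σ_l η̃^{kl} ∂³F̃/∂t^l∂t^i∂t^j`, the vector `e_0` is a unit
(`c^k_{0j} = δ^k_j`) and `e_{N+1}` is nilpotent (`c^k_{N+1,N+1} = 0`). -/
theorem extended_algebra_unit_and_nilpotent
    (N : ℕ) (η : Matrix (Fin N) (Fin N) ℝ) (hsym : η.IsSymm) (hdet : IsUnit η.det)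
    (F : (Fin N → ℝ) → ℝ) (hF : ContDiff ℝ (⊤ : ℕ∞) F)
    (hWDVV : WDVV F η⁻¹) :
    (∀ t : ExtIdx N → ℝ, ∀ j k : ExtIdx N,
        extC η F k (Sum.inl ()) j t = if k = j then 1 else 0) ∧
    (∀ t : ExtIdx N → ℝ, ∀ k : ExtIdx N,
        extC η F k (Sum.inr (Sum.inr ())) (Sum.inr (Sum.inr ())) t = 0) := by
  refine ⟨fun t j k => ?_, fun t k => ?_⟩
  · have hF2 : ContDiff ℝ 2 F := hF.of_le (by norm_cast)
    simp only [extC, thd_extF_unit hsym hF2]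
    rw [← Matrix.mul_apply, extEta_inv_mul hdet, Matrix.one_apply]
  · exact Finset.sum_eq_zero fun l _ => by
      rw [thd_extF_nilpotent η (hF.differentiable (by simp)), mul_zero]
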